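/- Let a, b, c, d, o be points of the Euclidean plane ℝ² and let r be a real number with dist o a = r, dist o b = r, dist o c = r (so a, b, c lie on a common circle with center o and radius r), and b ≠ c. If dist o d < r (d is strictly inside this circle) and a and d lie strictly on the same side of the line through b and c, then ∠ b d c > ∠ b a c. -/

import Mathlib

open EuclideanGeometry Real

lemma mul_lt_mul_of_sq_eq_add_sq {p q s t X Y : ℝ} (hs : 0 < s) (ht : 0 < t) (hX : 0 < X)
    (hY : 0 < Y) (hXs : X ^ 2 = p ^ 2 + s ^ 2) (hYt : Y ^ 2 = q ^ 2 + t ^ 2)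
    (h : p * t < q * s) : p * Y < q * X := by
  have key : (q * X) ^ 2 - (p * Y) ^ 2 = (q * s) ^ 2 - (p * t) ^ 2 := by
    rw [mul_pow, mul_pow, hXs, hYt]; ring
  rcases le_or_gt 0 p with hp | hp
  · have hq : 0 < q := pos_of_mul_pos_left ((mul_nonneg hp ht.le).trans_lt h) hs.le
    have h1 : (p * t) ^ 2 < (q * s) ^ 2 := pow_lt_pow_left₀ h (by positivity) two_ne_zero
    exact lt_of_pow_lt_pow_left₀ 2 (by positivity) (by linarith)
  · rcases le_or_gt 0 q with hq | hq
    · exact (mul_neg_of_neg_of_pos hp hY).trans_le (mul_nonneg hq hX.le)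
    · have hqs : q * s < 0 := mul_neg_of_neg_of_pos hq hs
      have hpY : p * Y < 0 := mul_neg_of_neg_of_pos hp hY
      have h1 : (q * s) ^ 2 < (p * t) ^ 2 := by nlinarith
      have h2 : -(q * X) < -(p * Y) :=
        lt_of_pow_lt_pow_left₀ 2 (by linarith) (by rw [neg_sq, neg_sq]; linarith)
      linarith

/-- Twice the signed area of the triangle `b c p`. -/
def signedArea (b c p : EuclideanSpace ℝ (Fin 2)) : ℝ :=
  (b 0 - p 0) * (c 1 - p 1) - (b 1 - p 1) * (c 0 - p 0)

lemma mem_affineSpan_of_signedArea_eq_zero {b c p : EuclideanSpace ℝ (Fin 2)} (hbc : b ≠ c)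
    (h : signedArea b c p = 0) : p ∈ affineSpan ℝ {b, c} := by
  have hN : (c 0 - b 0) ^ 2 + (c 1 - b 1) ^ 2 ≠ 0 := by
    intro h0
    apply hbc
    ext i
    fin_cases i <;> simp <;> nlinarith [sq_nonneg (c 0 - b 0), sq_nonneg (c 1 - b 1)]
  rw [mem_affineSpan_pair_iff_exists_lineMap_eq]
  refine ⟨((p 0 - b 0) * (c 0 - b 0) + (p 1 - b 1) * (c 1 - b 1)) /
    ((c 0 - b 0) ^ 2 + (c 1 - b 1) ^ 2), ?_⟩
  unfold signedArea at h
  ext i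
  fin_cases i <;> simp [AffineMap.lineMap_apply] <;> field_simp
  · linear_combination (c 1 - b 1) * h
  · linear_combination -(c 0 - b 0) * h

lemma signedArea_mul_pos {a b c d : EuclideanSpace ℝ (Fin 2)} (hbc : b ≠ c)
    (h : AffineSubspace.SSameSide (affineSpan ℝ {b, c}) a d) :
    0 < signedArea b c a * signedArea b c d := by
  have hd : signedArea b c d ≠ 0 := fun h0 =>
    h.2.2 (mem_affineSpan_of_signedArea_eq_zero hbc h0)
  obtain ⟨ha, -, p, hp, hray⟩ :=
    (AffineSubspace.sSameSide_iff_exists_left (left_mem_affineSpan_pair ℝ b c)).1 h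
  obtain ⟨t, rfl⟩ := (mem_affineSpan_pair_iff_exists_lineMap_eq).1 hp
  rcases hray with h0 | h0 | ⟨x, y, hx, hy, hxy⟩
  · rw [vsub_eq_zero_iff_eq] at h0
    exact absurd (h0 ▸ left_mem_affineSpan_pair ℝ b c) ha
  · rw [vsub_eq_zero_iff_eq] at h0
    exact absurd (h0 ▸ hp) h.2.2
  · have e0 := congrArg (fun v : EuclideanSpace ℝ (Fin 2) => v 0) hxy
    have e1 := congrArg (fun v : EuclideanSpace ℝ (Fin 2) => v 1) hxy
    simp [AffineMap.lineMap_apply] at e0 e1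
    have e : x * signedArea b c a = y * signedArea b c d := by
      unfold signedArea
      linear_combination (b 1 - c 1) * e0 - (b 0 - c 0) * e1
    have h2 : 0 < x * (signedArea b c a * signedArea b c d) := by
      rw [← mul_assoc, e, mul_assoc]
      exact mul_pos hy (mul_self_pos.2 hd)
    exact pos_of_mul_pos_right h2 hx.le

lemma inner_eq_coord (u v : EuclideanSpace ℝ (Fin 2)) :
    inner ℝ u v = u 0 * v 0 + u 1 * v 1 := by
  simp [PiLp.inner_apply, Fin.sum_univ_two, mul_comm]

lemma sq_norm_mul_norm_eq (b c p : EuclideanSpace ℝ (Fin 2)) :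
    (‖b - p‖ * ‖c - p‖) ^ 2 = (inner ℝ (b - p) (c - p)) ^ 2 + |signedArea b c p| ^ 2 := by
  rw [sq_abs, mul_pow, ← real_inner_self_eq_norm_sq, ← real_inner_self_eq_norm_sq]
  simp only [inner_eq_coord, signedArea, PiLp.sub_apply]
  ring

lemma norm_mul_norm_pos {b c p : EuclideanSpace ℝ (Fin 2)} (h : signedArea b c p ≠ 0) :
    0 < ‖b - p‖ * ‖c - p‖ := by
  have hsq := sq_norm_mul_norm_eq b c p
  have hpos := abs_pos.2 h
  refine (by positivity : 0 ≤ ‖b - p‖ * ‖c - p‖).lt_of_ne' fun h0 => ?_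
  rw [h0] at hsq
  nlinarith

lemma sq_dist_eq_coord (o p : EuclideanSpace ℝ (Fin 2)) :
    dist o p ^ 2 = (o 0 - p 0) ^ 2 + (o 1 - p 1) ^ 2 := by
  rw [dist_eq_norm, ← real_inner_self_eq_norm_sq, inner_eq_coord]
  simp only [PiLp.sub_apply]
  ring

lemma angle_lt_angle_of_inner_mul_lt {a b c d : EuclideanSpace ℝ (Fin 2)}
    (ha : signedArea b c a ≠ 0) (hd : signedArea b c d ≠ 0)
    (h : inner ℝ (b - d) (c - d) * |signedArea b c a| <
      inner ℝ (b - a) (c - a) * |signedArea b c d|) : ∠ b a c < ∠ b d c := by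
  have hbound (p : EuclideanSpace ℝ (Fin 2)) :
      inner ℝ (b - p) (c - p) / (‖b - p‖ * ‖c - p‖) ∈ Set.Icc (-1 : ℝ) 1 :=
    abs_le.1 (abs_real_inner_div_norm_mul_norm_le_one _ _)
  refine strictAntiOn_arccos (hbound d) (hbound a) ?_
  simp only [vsub_eq_sub]
  rw [div_lt_div_iff₀ (norm_mul_norm_pos hd) (norm_mul_norm_pos ha)]
  exact mul_lt_mul_of_sq_eq_add_sq (abs_pos.2 hd) (abs_pos.2 ha) (norm_mul_norm_pos hd)
    (norm_mul_norm_pos ha) (sq_norm_mul_norm_eq b c d) (sq_norm_mul_norm_eq b c a) h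

/-- The power of `p` with respect to a circle through `b` and `c` differs from
`⟪b - p, c - p⟫` by a multiple of the signed area of `b c p` not depending on `p`. -/
lemma exists_power_eq {b c o : EuclideanSpace ℝ (Fin 2)} {r : ℝ} (hbc : b ≠ c)
    (hb : dist o b = r) (hc : dist o c = r) :
    ∃ k : ℝ, ∀ p, dist o p ^ 2 - r ^ 2 = inner ℝ (b - p) (c - p) + k * signedArea b c p := by
  have hN : dist b c ^ 2 ≠ 0 := pow_ne_zero _ (dist_ne_zero.2 hbc)
  have hb2 : dist o b ^ 2 = r ^ 2 := by rw [hb]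
  have hc2 : dist o c ^ 2 = r ^ 2 := by rw [hc]
  rw [sq_dist_eq_coord] at hN hb2 hc2
  refine ⟨((b 0 + c 0 - 2 * o 0) * (b 1 - c 1) - (b 1 + c 1 - 2 * o 1) * (b 0 - c 0)) /
    ((b 0 - c 0) ^ 2 + (b 1 - c 1) ^ 2), fun p => ?_⟩
  rw [sq_dist_eq_coord, inner_eq_coord, ← hb2]
  simp only [signedArea, PiLp.sub_apply]
  have e : (o 0 - b 0) ^ 2 + (o 1 - b 1) ^ 2 = (o 0 - c 0) ^ 2 + (o 1 - c 1) ^ 2 := by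
    rw [hb2, hc2]
  field_simp
  linear_combination ((p 0 - b 0) * (b 0 - c 0) + (p 1 - b 1) * (b 1 - c 1)) * e

theorem inside_angle_gt
    (a b c d o : EuclideanSpace ℝ (Fin 2)) (r : ℝ)
    (ha : dist o a = r) (hb : dist o b = r) (hc : dist o c = r)
    (hbc : b ≠ c)
    (hd : dist o d < r)
    (hside : AffineSubspace.SSameSide (affineSpan ℝ {b, c}) a d) :
    ∠ b d c > ∠ b a c := by
  have hpos := signedArea_mul_pos hbc hside
  obtain ⟨k, hk⟩ := exists_power_eq hbc hb hc
  have hka := hk a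
  have hkd := hk d
  rw [ha, sub_self] at hka
  have hlt : dist o d ^ 2 < r ^ 2 := pow_lt_pow_left₀ hd dist_nonneg two_ne_zero
  refine angle_lt_angle_of_inner_mul_lt (left_ne_zero_of_mul hpos.ne')
    (right_ne_zero_of_mul hpos.ne') ?_
  rw [show inner ℝ (b - a) (c - a) = -k * signedArea b c a by linarith]
  rcases pos_and_pos_or_neg_and_neg_of_mul_pos hpos with ⟨h1, h2⟩ | ⟨h1, h2⟩
  · rw [abs_of_pos h1, abs_of_pos h2]
    nlinarith
  · rw [abs_of_neg h1, abs_of_neg h2]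
    nlinarith
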